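/- The poset of formal balls (BΣ^∞, ⊑_{q_b}) is a continuous domain: it is a dcpo and for every (x,r) ∈ BΣ^∞ the set ⇓(x,r) of elements way below (x,r) is directed with least upper bound (x,r). -/

import Mathlib

open scoped NNReal ENNReal

attribute [local instance] Classical.propDecidable

universe u

structure QuasiMetric (X : Type u) where
  d : X → X → ℝ≥0
  eq_iff : ∀ x y, (d x y = 0 ∧ d y x = 0) ↔ x = y
  triangle : ∀ x y z, d x y ≤ d x z + d z y

/-- The order on formal balls: `(x,r) ⊑ (y,s)` iff `d x y ≤ r - s` (real subtraction). -/
def BallLE {X : Type u} (d : X → X → ℝ≥0) (b c : X × ℝ≥0) : Prop :=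
  (d b.1 c.1 : ℝ) ≤ (b.2 : ℝ) - (c.2 : ℝ)

def IsUpperBound {β : Type*} (le : β → β → Prop) (D : Set β) (u : β) : Prop :=
  ∀ a ∈ D, le a u

def IsLub' {β : Type*} (le : β → β → Prop) (D : Set β) (u : β) : Prop :=
  IsUpperBound le D u ∧ ∀ v, IsUpperBound le D v → le u v

def DirectedSubset {β : Type*} (le : β → β → Prop) (D : Set β) : Prop :=
  D.Nonempty ∧ ∀ a ∈ D, ∀ b ∈ D, ∃ c ∈ D, le a c ∧ le b c

/-- `a` is way below `b`. -/
def WayBelow {β : Type*} (le : β → β → Prop) (a b : β) : Prop :=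
  ∀ D : Set β, DirectedSubset le D → ∀ s, IsLub' le D s → le b s → ∃ u ∈ D, le a u

def LeftKCauchyNet {X : Type u} {Λ : Type*} (d : X → X → ℝ≥0) (le : Λ → Λ → Prop)
    (f : Λ → X) : Prop :=
  ∀ ε : ℝ≥0, 0 < ε → ∃ a, ∀ b c, le a b → le b c → d (f b) (f c) < ε

/-- `x` is a Yoneda-limit of the net `f`: for all `y`, `d x y = inf_a sup_{b ≥ a} d (f b) y`
(computed in `ℝ≥0∞` so that the inf/sup always exist). -/
def IsYonedaLimit {X : Type u} {Λ : Type*} (d : X → X → ℝ≥0) (le : Λ → Λ → Prop)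
    (f : Λ → X) (x : X) : Prop :=
  ∀ y, (d x y : ℝ≥0∞) = ⨅ a : Λ, ⨆ b : Λ, ⨆ _ : le a b, (d (f b) y : ℝ≥0∞)

/-- Finite and infinite words over `α`: partial functions on `ℕ` with downward-closed domain. -/
def Word (α : Type u) : Type u := {f : ℕ → Option α // ∀ n, f n = none → f (n + 1) = none}

def emptyWord (α : Type u) : Word α := ⟨fun _ => none, fun _ _ => rfl⟩

/-- The prefix order on words. -/
def wpre {α : Type u} (x y : Word α) : Prop := ∀ n a, x.1 n = some a → y.1 n = some a

/-- The length of a word, in `ℕ∞`. -/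
noncomputable def wlen {α : Type u} (x : Word α) : ℕ∞ := ⨅ n ∈ {n : ℕ | x.1 n = none}, (n : ℕ∞)

/-- `pw n = 2^{-n}`, with `2^{-∞} = 0`. -/
noncomputable def pw (n : ℕ∞) : ℝ≥0 := if n = ⊤ then 0 else (2 : ℝ≥0)⁻¹ ^ n.toNat

/-- The balanced quasi-metric on words. -/
noncomputable def qb {α : Type u} (x y : Word α) : ℝ≥0 :=
  if wpre x y then pw (wlen x) - pw (wlen y) else 1

noncomputable def wL {α : Type u} (x : Word α) : ℝ := (pw (wlen x) : ℝ)

theorem pw_anti {a b : ℕ∞} (h : a ≤ b) : pw b ≤ pw a := by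
  unfold pw
  by_cases hb : b = ⊤
  · simp [hb]
  · have ha : a ≠ ⊤ := fun h' => hb (by rw [h'] at h; exact top_le_iff.mp h)
    rw [if_neg ha, if_neg hb]
    apply pow_le_pow_of_le_one (by simp)
    · exact inv_le_one_of_one_le₀ (by norm_num)
    · exact ENat.toNat_le_toNat h hb

theorem pw_coe (n : ℕ) : (pw (n : ℕ∞) : ℝ) = (2⁻¹ : ℝ) ^ n := by
  simp [pw]

theorem pw_le_one (a : ℕ∞) : pw a ≤ 1 := by
  have h := pw_anti (bot_le : (0 : ℕ∞) ≤ a)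
  simpa [pw] using h

theorem wL_nonneg {α : Type u} (x : Word α) : 0 ≤ wL x := NNReal.coe_nonneg _

theorem wL_le_one {α : Type u} (x : Word α) : wL x ≤ 1 := by
  exact_mod_cast pw_le_one (wlen x)

theorem wlen_mono {α : Type u} {x y : Word α} (h : wpre x y) : wlen x ≤ wlen y := by
  unfold wlen
  refine le_iInf₂ fun n hn => iInf₂_le n ?_
  show x.1 n = none
  cases hx : x.1 n with
  | none => rfl
  | some a =>
    have h1 := h n a hx
    have h2 : y.1 n = none := hn
    rw [h2] at h1
    cases h1

theorem wL_anti {α : Type u} {x y : Word α} (h : wpre x y) : wL y ≤ wL x := by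
  exact_mod_cast pw_anti (wlen_mono h)

theorem wpre_trans {α : Type u} {x y z : Word α} (h : wpre x y) (h' : wpre y z) : wpre x z :=
  fun n a hx => h' n a (h n a hx)

theorem wpre_refl {α : Type u} (x : Word α) : wpre x x := fun _ _ h => h

def trunc {α : Type u} (n : ℕ) (x : Word α) : Word α :=
  ⟨fun m => if m < n then x.1 m else none, fun m hm => by
    by_cases h : m + 1 < n
    · have h' : m < n := by omega
      simp only [h, h', if_true] at hm ⊢
      exact x.2 m hm
    · simp [h]⟩

theorem trunc_some {α : Type u} {n m : ℕ} {x : Word α} {a : α} :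
    (trunc n x).1 m = some a ↔ m < n ∧ x.1 m = some a := by
  show (if m < n then x.1 m else none) = some a ↔ _
  by_cases h : m < n <;> simp [h]

theorem trunc_pre {α : Type u} (n : ℕ) (x : Word α) : wpre (trunc n x) x :=
  fun _ _ h => (trunc_some.1 h).2

theorem trunc_mono {α : Type u} {n m : ℕ} {x y : Word α} (hn : n ≤ m) (h : wpre x y) :
    wpre (trunc n x) (trunc m y) :=
  fun k a hk => trunc_some.2 ⟨lt_of_lt_of_le (trunc_some.1 hk).1 hn, h k a (trunc_some.1 hk).2⟩

theorem wL_trunc {α : Type u} (n : ℕ) (x : Word α) : wL (trunc n x) ≤ wL x + (2⁻¹ : ℝ) ^ n := by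
  have h : min (wlen x) (n : ℕ∞) ≤ wlen (trunc n x) := by
    conv_rhs => unfold wlen
    refine le_iInf₂ fun m hm => ?_
    have hm' : (if m < n then x.1 m else none) = none := hm
    by_cases hmn : m < n
    · rw [if_pos hmn] at hm'
      exact (min_le_left _ _).trans (iInf₂_le m hm')
    · exact (min_le_right _ _).trans (by exact_mod_cast not_lt.1 hmn)
  have h2 : wL (trunc n x) ≤ (pw (min (wlen x) (n : ℕ∞)) : ℝ) := by exact_mod_cast pw_anti h
  refine h2.trans ?_
  have hp : (0:ℝ) ≤ (2⁻¹ : ℝ) ^ n := by positivity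
  rcases min_choice (wlen x) (n : ℕ∞) with h3 | h3
  · rw [h3]; unfold wL; linarith
  · rw [h3, pw_coe]; linarith [wL_nonneg x]

theorem le_iff {α : Type u} (b c : Word α × ℝ≥0) : BallLE qb b c ↔
    ((c.2 : ℝ) + 1 ≤ b.2 ∨ (wpre b.1 c.1 ∧ (c.2 : ℝ) - wL c.1 ≤ b.2 - wL b.1)) := by
  unfold BallLE qb
  by_cases h : wpre b.1 c.1
  · have h1 : pw (wlen c.1) ≤ pw (wlen b.1) := pw_anti (wlen_mono h)
    rw [if_pos h, NNReal.coe_sub h1]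
    change wL b.1 - wL c.1 ≤ _ ↔ _
    constructor
    · intro h2; right; exact ⟨h, by linarith⟩
    · rintro (h2 | h2)
      · linarith [wL_nonneg c.1, wL_le_one b.1]
      · linarith [h2.2]
  · rw [if_neg h]
    constructor
    · intro h2; left; simp at h2; linarith
    · rintro (h2 | h2)
      · simp; linarith
      · exact absurd h2.1 h

theorem le_rad {α : Type u} {b c : Word α × ℝ≥0} (h : BallLE qb b c) : (c.2 : ℝ) ≤ b.2 := by
  rcases (le_iff b c).1 h with h | h
  · linarith
  · linarith [h.2, wL_anti h.1]

theorem le_tr {α : Type u} {b c d : Word α × ℝ≥0} (h : BallLE qb b c) (h' : BallLE qb c d) :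
    BallLE qb b d := by
  have r1 := le_rad h
  have r2 := le_rad h'
  rw [le_iff] at *
  rcases h with h | h
  · left; linarith
  · rcases h' with h' | h'
    · left; linarith
    · right; exact ⟨wpre_trans h.1 h'.1, h'.2.trans h.2⟩

theorem le_rf {α : Type u} (b : Word α × ℝ≥0) : BallLE qb b b :=
  (le_iff b b).2 (Or.inr ⟨wpre_refl _, le_rfl⟩)

theorem exists_sup {α : Type u} (P : Set (Word α))
    (hd : ∀ x ∈ P, ∀ y ∈ P, ∃ z ∈ P, wpre x z ∧ wpre y z) :
    ∃ z : Word α, ∀ n a, z.1 n = some a ↔ ∃ x ∈ P, x.1 n = some a := by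
  classical
  refine ⟨⟨fun n => if h : ∃ a, ∃ x ∈ P, x.1 n = some a then some h.choose else none, ?_⟩, ?_⟩
  · intro n hn
    by_cases h : ∃ a, ∃ x ∈ P, x.1 n = some a
    · simp [h] at hn
    · refine dif_neg ?_
      rintro ⟨a, x, hx, hxa⟩
      cases hx' : x.1 n with
      | none => rw [x.2 n hx'] at hxa; cases hxa
      | some b => exact h ⟨b, x, hx, hx'⟩
  · intro n a
    show (if h : ∃ a, ∃ x ∈ P, x.1 n = some a then some h.choose else none) = some a ↔ _
    by_cases h : ∃ a, ∃ x ∈ P, x.1 n = some a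
    · rw [dif_pos h]
      constructor
      · intro h1
        have := h.choose_spec
        rw [Option.some.inj h1] at this
        exact this
      · rintro ⟨x, hx, hxa⟩
        obtain ⟨y, hy, hya⟩ := h.choose_spec
        obtain ⟨w, _, h1, h2⟩ := hd x hx y hy
        rw [← h2 n _ hya, h1 n _ hxa]
    · rw [dif_neg h]
      constructor
      · intro h; cases h
      · intro h'; exact absurd ⟨a, h'⟩ h

theorem compact {α : Type u} (P : Set (Word α)) (hne : P.Nonempty)
    (hd : ∀ x ∈ P, ∀ y ∈ P, ∃ z ∈ P, wpre x z ∧ wpre y z) (z : Word α)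
    (hz : ∀ n a, z.1 n = some a ↔ ∃ x ∈ P, x.1 n = some a) (n : ℕ) :
    ∃ x ∈ P, wpre (trunc n z) x := by
  induction n with
  | zero =>
    obtain ⟨x, hx⟩ := hne
    exact ⟨x, hx, fun m a h => absurd (trunc_some.1 h).1 (by omega)⟩
  | succ n ih =>
    obtain ⟨x, hx, hp⟩ := ih
    cases hzn : z.1 n with
    | none =>
      refine ⟨x, hx, fun m a h => ?_⟩
      obtain ⟨h1, h2⟩ := trunc_some.1 h
      have : m ≠ n := by rintro rfl; rw [hzn] at h2; cases h2
      exact hp m a (trunc_some.2 ⟨by omega, h2⟩)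
    | some b =>
      obtain ⟨y, hy, hyb⟩ := (hz n b).1 hzn
      obtain ⟨w, hw, h1, h2⟩ := hd x hx y hy
      refine ⟨w, hw, fun m a h => ?_⟩
      obtain ⟨h3, h4⟩ := trunc_some.1 h
      by_cases hm : m = n
      · subst hm
        rw [hzn] at h4
        cases h4
        exact h2 _ _ hyb
      · exact h1 m a (hp m a (trunc_some.2 ⟨by omega, h4⟩))

theorem ex_half_pow_lt {ε : ℝ} (h : 0 < ε) : ∃ n : ℕ, (2⁻¹ : ℝ) ^ n < ε :=
  exists_pow_lt_of_lt_one h (by norm_num)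

theorem lub_data {α : Type u} (D : Set (Word α × ℝ≥0)) (hD : DirectedSubset (BallLE qb) D) :
    ∃ (z : Word α) (R : ℝ≥0), IsLub' (BallLE qb) D (z, R) ∧
      (∀ ε : ℝ, 0 < ε → ∃ d ∈ D, (d.2 : ℝ) < R + ε) ∧
      (∀ n : ℕ, ∀ ε : ℝ, 0 < ε → ∃ d ∈ D, wpre (trunc n z) d.1 ∧
        (d.2 : ℝ) - wL d.1 ≤ R - wL z + ε) := by
  obtain ⟨hne, hdir⟩ := hD
  obtain ⟨R, hR1, hR2⟩ : ∃ R : ℝ≥0, (∀ d ∈ D, R ≤ d.2) ∧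
      (∀ ε : ℝ, 0 < ε → ∃ d ∈ D, (d.2 : ℝ) < R + ε) := by
    refine ⟨sInf (Prod.snd '' D), fun d hd => csInf_le (OrderBot.bddBelow _) ⟨d, hd, rfl⟩, ?_⟩
    intro ε hε
    have hlt : sInf (Prod.snd '' D) < sInf (Prod.snd '' D) + ε.toNNReal :=
      lt_add_of_pos_right _ (Real.toNNReal_pos.2 hε)
    obtain ⟨_, ⟨d, hd, rfl⟩, h⟩ := exists_lt_of_csInf_lt (hne.image _) hlt
    refine ⟨d, hd, ?_⟩
    have h' : (d.2 : ℝ) < ((sInf (Prod.snd '' D) + ε.toNNReal : ℝ≥0) : ℝ) := by exact_mod_cast h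
    rw [NNReal.coe_add, Real.coe_toNNReal _ hε.le] at h'
    exact h'
  have hR1' : ∀ d ∈ D, (R : ℝ) ≤ d.2 := fun d hd => by exact_mod_cast hR1 d hd
  -- below radius R + 1, order forces prefix
  have key : ∀ d ∈ D, (d.2 : ℝ) < R + 1 → ∀ e ∈ D, BallLE qb d e →
      wpre d.1 e.1 ∧ (e.2 : ℝ) - wL e.1 ≤ d.2 - wL d.1 := by
    intro d _ hd1 e he hde
    rcases (le_iff d e).1 hde with h | h
    · linarith [hR1' e he]
    · exact h
  let P : Set (Word α) := {x | ∃ d ∈ D, (d.2 : ℝ) < R + 1 ∧ d.1 = x}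
  have hPne : P.Nonempty := by
    obtain ⟨d, hd, h⟩ := hR2 1 one_pos
    exact ⟨d.1, d, hd, h, rfl⟩
  have hPd : ∀ x ∈ P, ∀ y ∈ P, ∃ z ∈ P, wpre x z ∧ wpre y z := by
    rintro _ ⟨d, hd, hd1, rfl⟩ _ ⟨e, he, he1, rfl⟩
    obtain ⟨f, hf, h1, h2⟩ := hdir d hd e he
    exact ⟨f.1, ⟨f, hf, by linarith [le_rad h1], rfl⟩, (key d hd hd1 f hf h1).1,
      (key e he he1 f hf h2).1⟩
  obtain ⟨z, hz⟩ := exists_sup P hPd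
  have hcomp := compact P hPne hPd z hz
  have hPz : ∀ x ∈ P, wpre x z := fun x hx n a h => (hz n a).2 ⟨x, hx, h⟩
  have ub1 : ∀ d ∈ D, (d.2 : ℝ) < R + 1 → BallLE qb d (z, R) := by
    intro d hd hd1
    rw [le_iff]
    right
    refine ⟨hPz _ ⟨d, hd, hd1, rfl⟩, ?_⟩
    refine le_of_forall_pos_le_add fun ε hε => ?_
    obtain ⟨n, hn⟩ := ex_half_pow_lt hε
    obtain ⟨_, ⟨e, he, he1, rfl⟩, hpe⟩ := hcomp n
    obtain ⟨f, hf, h1, h2⟩ := hdir d hd e he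
    have k1 := key d hd hd1 f hf h1
    have k2 := key e he he1 f hf h2
    have := wL_anti (wpre_trans hpe k2.1)
    have := wL_trunc n z
    have := hR1' f hf
    show (R : ℝ) - wL z ≤ _
    linarith [k1.2]
  refine ⟨z, R, ⟨?_, ?_⟩, hR2, ?_⟩
  · intro d hd
    obtain ⟨e, he, he1⟩ := hR2 1 one_pos
    obtain ⟨f, hf, h1, h2⟩ := hdir d hd e he
    exact le_tr h1 (ub1 f hf (by linarith [le_rad h2]))
  · rintro ⟨w, t⟩ hv
    rw [le_iff]
    by_cases ht : (t : ℝ) + 1 ≤ R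
    · exact Or.inl ht
    right
    push Not at ht
    obtain ⟨d0, hd0, hd0'⟩ := hR2 ((t : ℝ) + 1 - R) (by linarith)
    have htR : (t : ℝ) ≤ R := by
      refine le_of_forall_pos_le_add fun ε hε => ?_
      obtain ⟨d, hd, h⟩ := hR2 ε hε
      have : (t : ℝ) ≤ d.2 := le_rad (hv d hd)
      linarith
    have small : ∀ f ∈ D, (f.2 : ℝ) ≤ d0.2 →
        wpre f.1 w ∧ (t : ℝ) - wL w ≤ f.2 - wL f.1 := by
      intro f hf hfd
      rcases (le_iff f (w, t)).1 (hv f hf) with h | h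
      · have h : (t : ℝ) + 1 ≤ f.2 := h
        linarith
      · exact h
    constructor
    · intro n a hza
      obtain ⟨_, ⟨d, hd, hd1, rfl⟩, hda⟩ := (hz n a).1 hza
      obtain ⟨f, hf, h1, h2⟩ := hdir d hd d0 hd0
      exact (small f hf (le_rad h2)).1 n a ((key d hd hd1 f hf h1).1 n a hda)
    · show (t : ℝ) - wL w ≤ R - wL z
      refine le_of_forall_pos_le_add fun ε hε => ?_
      obtain ⟨d, hd, h⟩ := hR2 ε hε
      obtain ⟨f, hf, h1, h2⟩ := hdir d hd d0 hd0
      have k := (small f hf (le_rad h2)).2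
      have := wL_anti (hPz f.1 ⟨f, hf, by linarith [le_rad h2], rfl⟩)
      linarith [le_rad h1]
  · intro n ε hε
    obtain ⟨_, ⟨e, he, he1, rfl⟩, hpe⟩ := hcomp n
    obtain ⟨d, hd, h⟩ := hR2 ε hε
    obtain ⟨f, hf, h1, h2⟩ := hdir d hd e he
    refine ⟨f, hf, wpre_trans hpe (key e he he1 f hf h2).1, ?_⟩
    have := wL_anti (hPz f.1 ⟨f, hf, by linarith [le_rad h2], rfl⟩)
    linarith [le_rad h1]

theorem wb_trunc {α : Type u} (y : Word α) (s r : ℝ≥0) (n : ℕ)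
    (h : (s : ℝ) - wL y < r - wL (trunc n y)) :
    WayBelow (BallLE qb) (trunc n y, r) (y, s) := by
  intro D hD v hv hbv
  obtain ⟨z, R, hlub, hr, hc⟩ := lub_data D hD
  have hle : BallLE qb (y, s) (z, R) := le_tr hbv (hv.2 _ hlub.1)
  rcases (le_iff _ _).1 hle with h1 | ⟨h1, h2⟩
  · have h1 : (R : ℝ) + 1 ≤ s := h1
    have := wL_anti (trunc_pre n y)
    obtain ⟨d, hd, hd'⟩ := hr ((r : ℝ) - 1 - R) (by linarith)
    refine ⟨d, hd, (le_iff _ _).2 (Or.inl ?_)⟩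
    show (d.2 : ℝ) + 1 ≤ r
    linarith
  · have h1 : wpre y z := h1
    have h2 : (R : ℝ) - wL z ≤ s - wL y := h2
    obtain ⟨d, hd, hp, hd'⟩ := hc n ((r - wL (trunc n y)) - (s - wL y)) (by linarith)
    refine ⟨d, hd, (le_iff _ _).2 (Or.inr ⟨wpre_trans (trunc_mono le_rfl h1) hp, ?_⟩)⟩
    show (d.2 : ℝ) - wL d.1 ≤ r - wL (trunc n y)
    linarith

theorem wb_le {α : Type u} {a b : Word α × ℝ≥0} (h : WayBelow (BallLE qb) a b) :
    BallLE qb a b := by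
  obtain ⟨u, hu, hau⟩ := h {b} ⟨⟨b, rfl⟩, by
    rintro _ rfl _ rfl
    exact ⟨_, rfl, le_rf _, le_rf _⟩⟩ b ⟨by rintro _ rfl; exact le_rf _, fun v hv => hv b rfl⟩
    (le_rf b)
  cases hu
  exact hau

theorem approx {α : Type u} (y : Word α) (s : ℝ≥0) :
    ∃ E : Set (Word α × ℝ≥0), DirectedSubset (BallLE qb) E ∧
      IsLub' (BallLE qb) E (y, s) ∧ ∀ e ∈ E, WayBelow (BallLE qb) e (y, s) := by
  have hex : ∀ n : ℕ, ∃ r : ℝ≥0, (r : ℝ) = s + wL (trunc n y) - wL y + (2⁻¹ : ℝ) ^ n := by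
    intro n
    have h1 := wL_anti (trunc_pre n y)
    have h2 : (0:ℝ) < (2⁻¹ : ℝ) ^ n := by positivity
    have h3 := s.coe_nonneg
    exact ⟨⟨s + wL (trunc n y) - wL y + (2⁻¹ : ℝ) ^ n, by linarith⟩, rfl⟩
  choose r hr using hex
  have wb : ∀ n, WayBelow (BallLE qb) (trunc n y, r n) (y, s) := by
    intro n
    apply wb_trunc
    have h2 : (0:ℝ) < (2⁻¹ : ℝ) ^ n := by positivity
    rw [hr]; linarith
  have anti : ∀ {n m : ℕ}, n ≤ m → (2⁻¹ : ℝ) ^ m ≤ (2⁻¹ : ℝ) ^ n := fun h =>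
    pow_le_pow_of_le_one (by norm_num) (by norm_num) h
  have mono : ∀ n m, n ≤ m → BallLE qb (trunc n y, r n) (trunc m y, r m) := by
    intro n m h
    refine (le_iff _ _).2 (Or.inr ⟨trunc_mono h (wpre_refl y), ?_⟩)
    show (r m : ℝ) - wL (trunc m y) ≤ r n - wL (trunc n y)
    rw [hr, hr]; linarith [anti h]
  refine ⟨Set.range fun n => (trunc n y, r n), ⟨⟨_, 0, rfl⟩, ?_⟩, ⟨?_, ?_⟩, ?_⟩
  · rintro _ ⟨n, rfl⟩ _ ⟨m, rfl⟩
    exact ⟨_, ⟨max n m, rfl⟩, mono _ _ (le_max_left _ _), mono _ _ (le_max_right _ _)⟩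
  · rintro _ ⟨n, rfl⟩
    exact wb_le (wb n)
  · rintro ⟨w, t⟩ hv
    rw [le_iff]
    by_cases ht : (t : ℝ) + 1 ≤ s
    · exact Or.inl ht
    right
    push Not at ht
    obtain ⟨N, hN⟩ := ex_half_pow_lt (ε := ((t : ℝ) + 1 - s) / 2) (by linarith)
    have big : ∀ n, N ≤ n → wpre (trunc n y) w ∧ (t : ℝ) - wL w ≤ s - wL y + (2⁻¹ : ℝ) ^ n := by
      intro n hn
      rcases (le_iff _ _).1 (hv _ ⟨n, rfl⟩) with h | ⟨h1, h2⟩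
      · have h : (t : ℝ) + 1 ≤ r n := h
        rw [hr] at h
        linarith [anti hn, wL_trunc n y]
      · have h2 : (t : ℝ) - wL w ≤ r n - wL (trunc n y) := h2
        rw [hr] at h2
        exact ⟨h1, by linarith⟩
    constructor
    · intro n a h
      exact (big (max N (n + 1)) (le_max_left _ _)).1 n a
        (trunc_some.2 ⟨by have := le_max_right N (n + 1); omega, h⟩)
    · show (t : ℝ) - wL w ≤ s - wL y
      refine le_of_forall_pos_le_add fun ε hε => ?_
      obtain ⟨n, hn⟩ := ex_half_pow_lt hε
      have := (big (max N n) (le_max_left _ _)).2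
      linarith [anti (le_max_right N n)]
  · rintro _ ⟨n, rfl⟩
    exact wb n

theorem stmt15 {α : Type u} :
    (∀ D : Set (Word α × ℝ≥0), DirectedSubset (BallLE qb) D →
      ∃ u, IsLub' (BallLE qb) D u) ∧
    (∀ b : Word α × ℝ≥0,
      DirectedSubset (BallLE qb) {a | WayBelow (BallLE qb) a b} ∧
      IsLub' (BallLE qb) {a | WayBelow (BallLE qb) a b} b) := by
  refine ⟨fun D hD => ?_, fun b => ?_⟩
  · obtain ⟨z, R, h, _⟩ := lub_data D hD
    exact ⟨_, h⟩
  · obtain ⟨y, s⟩ := b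
    obtain ⟨E, hE, hl, hw⟩ := approx y s
    refine ⟨⟨?_, ?_⟩, fun a ha => wb_le ha, fun v hv => hl.2 v fun e he => hv e (hw e he)⟩
    · obtain ⟨e, he⟩ := hE.1
      exact ⟨e, hw e he⟩
    · intro a ha b hb
      obtain ⟨e, he, h1⟩ := ha E hE _ hl (le_rf _)
      obtain ⟨f, hf, h2⟩ := hb E hE _ hl (le_rf _)
      obtain ⟨g, hg, h3, h4⟩ := hE.2 e he f hf
      exact ⟨g, hw g hg, le_tr h1 h3, le_tr h2 h4⟩
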